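/- Define the polynomial g(x,y) = 9447840*x^6*y^2 - 4199040*y^6*x^2 + 53800200*x^6 + 1679616*y^8 + 124857369*x^4 + 127471968*y^4 - 159339960*x^2*y^2 - 24820992*y^6 + 46539360*y^4*x^2 - 105471720*y^2*x^4 - 4933872*y^4*x^4 + 120670225 + 8503056*x^8 - 250879824*y^2 + 156799890*x^2. Then the set of real points (x,y) with g(x,y) = 0, ∂g/∂x(x,y) = 0 and ∂g/∂y(x,y) = 0 is exactly the two-element set {(0, 13/6), (0, -13/6)}. -/

import Mathlib

/-- The polynomial defining the parallel lines at offset r = 2/3 to the hyperbola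
4*y^2 - 9*x^2 = 9. -/
noncomputable def g18 (x y : ℝ) : ℝ :=
  9447840*x^6*y^2 - 4199040*y^6*x^2 + 53800200*x^6 + 1679616*y^8 + 124857369*x^4 +
    127471968*y^4 - 159339960*x^2*y^2 - 24820992*y^6 + 46539360*y^4*x^2 - 105471720*y^2*x^4 -
    4933872*y^4*x^4 + 120670225 + 8503056*x^8 - 250879824*y^2 + 156799890*x^2

theorem g18_cert (u v : ℝ) (hG : (9447840)*u^3*v^1 + (-4199040)*u^1*v^3 + (53800200)*u^3*v^0 + (1679616)*u^0*v^4 + (124857369)*u^2*v^0 + (127471968)*u^0*v^2 + (-159339960)*u^1*v^1 + (-24820992)*u^0*v^3 + (46539360)*u^1*v^2 + (-105471720)*u^2*v^1 + (-4933872)*u^2*v^2 + (120670225)*u^0*v^0 + (8503056)*u^4*v^0 + (-250879824)*u^0*v^1 + (156799890)*u^1*v^0 = 0)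
    (hU : (28343520)*u^2*v^1 + (-4199040)*u^0*v^3 + (161400600)*u^2*v^0 + (249714738)*u^1*v^0 + (-159339960)*u^0*v^1 + (46539360)*u^0*v^2 + (-210943440)*u^1*v^1 + (-9867744)*u^1*v^2 + (34012224)*u^3*v^0 + (156799890)*u^0*v^0 = 0)
    (hV : (9447840)*u^3*v^0 + (-12597120)*u^1*v^2 + (6718464)*u^0*v^3 + (254943936)*u^0*v^1 + (-159339960)*u^1*v^0 + (-74462976)*u^0*v^2 + (93078720)*u^1*v^1 + (-105471720)*u^2*v^0 + (-9867744)*u^2*v^1 + (-250879824)*u^0*v^0 = 0) : u * (169*u^2+432)^2 = 0 := by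
  linear_combination ((-443559782441/15544686096576)*u^1*v^0 + (-3653079102037/349755437172960)*u^0*v^1 + (-1850838391799/412826089777920)*u^0*v^0 + (-946371625/431796836016)*u^1*v^1 + (21444956899/2775836802960)*u^0*v^2 + (-1353059233/359830696680)*u^2*v^0)*hG + ((142243564585/69951087434592)*u^0*v^2 + (-26693186538853/2518239147645312)*u^0*v^1 + (4879062899239201/271969827945693696)*u^0*v^0 + (-7447556264147/2098532623037760)*u^1*v^1 + (1248868650642167/151094348858718720)*u^1*v^0 + (441174023939/46634058289728)*u^2*v^0 + (1048043527/1295390508048)*u^2*v^1 + (-743027821/5829257286216)*u^0*v^3 + (-7559838059/3331004163552)*u^1*v^2 + (1353059233/1439322786720)*u^3*v^0)*hU + ((607156390145/67045440144384)*u^0*v^0 + (-235625403937561/25182391476453120)*u^0*v^1 + (106798159/9693483840)*u^0*v^2 + (-693668329/344926466640)*u^0*v^3)*hV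

theorem g18_dx (x y : ℝ) : deriv (fun t : ℝ => g18 t y) x = 2*x*((28343520)*(x^2)^2*(y^2)^1 + (-4199040)*(x^2)^0*(y^2)^3 + (161400600)*(x^2)^2*(y^2)^0 + (249714738)*(x^2)^1*(y^2)^0 + (-159339960)*(x^2)^0*(y^2)^1 + (46539360)*(x^2)^0*(y^2)^2 + (-210943440)*(x^2)^1*(y^2)^1 + (-9867744)*(x^2)^1*(y^2)^2 + (34012224)*(x^2)^3*(y^2)^0 + (156799890)*(x^2)^0*(y^2)^0) := by
  unfold g18
  apply HasDerivAt.deriv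
  have h : ∀ (n : ℕ) (c : ℝ), HasDerivAt (fun t : ℝ => c * t^n) (c * (n * x^(n-1))) x :=
    fun n c => (hasDerivAt_pow n x).const_mul c
  convert (((((h 8 8503056).add (h 6 (9447840*y^2+53800200))).add
    (h 4 (124857369 - 105471720*y^2 - 4933872*y^4))).add
    (h 2 (156799890 - 4199040*y^6 - 159339960*y^2 + 46539360*y^4))).add
    (h 0 (1679616*y^8 + 127471968*y^4 - 24820992*y^6 + 120670225 - 250879824*y^2))) using 1
  · funext t
    simp only [Pi.add_apply]
    ring
  · push_cast
    ring

theorem g18_dy (x y : ℝ) : deriv (fun t : ℝ => g18 x t) y = 2*y*((9447840)*(x^2)^3*(y^2)^0 + (-12597120)*(x^2)^1*(y^2)^2 + (6718464)*(x^2)^0*(y^2)^3 + (254943936)*(x^2)^0*(y^2)^1 + (-159339960)*(x^2)^1*(y^2)^0 + (-74462976)*(x^2)^0*(y^2)^2 + (93078720)*(x^2)^1*(y^2)^1 + (-105471720)*(x^2)^2*(y^2)^0 + (-9867744)*(x^2)^2*(y^2)^1 + (-250879824)*(x^2)^0*(y^2)^0) := by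
  unfold g18
  apply HasDerivAt.deriv
  have h : ∀ (n : ℕ) (c : ℝ), HasDerivAt (fun t : ℝ => c * t^n) (c * (n * y^(n-1))) y :=
    fun n c => (hasDerivAt_pow n y).const_mul c
  convert (((((h 8 1679616).add (h 6 (-4199040*x^2 - 24820992))).add
    (h 4 (127471968 + 46539360*x^2 - 4933872*x^4))).add
    (h 2 (9447840*x^6 - 159339960*x^2 - 105471720*x^4 - 250879824))).add
    (h 0 (53800200*x^6 + 124857369*x^4 + 120670225 + 8503056*x^8 + 156799890*x^2))) using 1
  · funext t
    simp only [Pi.add_apply]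
    ring
  · push_cast
    ring

theorem hyperbola_critical_two_singular_points :
    {q : ℝ × ℝ | g18 q.1 q.2 = 0 ∧
        deriv (fun t : ℝ => g18 t q.2) q.1 = 0 ∧
        deriv (fun t : ℝ => g18 q.1 t) q.2 = 0}
      = {((0 : ℝ), (13/6 : ℝ)), ((0 : ℝ), (-13/6 : ℝ))} := by
  ext ⟨x, y⟩
  simp only [Set.mem_setOf_eq, Set.mem_insert_iff, Set.mem_singleton_iff, Prod.mk.injEq]
  rw [g18_dx, g18_dy]
  constructor
  · rintro ⟨hg, hx, hy⟩
    unfold g18 at hg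
    have hy0 : y ≠ 0 := by
      rintro rfl
      have : (0:ℝ) < 53800200*x^6 + 124857369*x^4 + 120670225 + 8503056*x^8 + 156799890*x^2 := by
        positivity
      linarith
    have hV := (mul_eq_zero.mp hy).resolve_left (mul_ne_zero two_ne_zero hy0)
    have hx0 : x = 0 := by
      by_contra hx0
      have hU := (mul_eq_zero.mp hx).resolve_left (mul_ne_zero two_ne_zero hx0)
      have h := g18_cert (x^2) (y^2) (by linear_combination hg) hU hV
      have : 0 < x^2 * (169*(x^2)^2+432)^2 := by positivity
      linarith
    subst hx0
    have h1 : (36*y^2-169)^3 * (36*y^2-25) = 0 := by linear_combination hg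
    have h2 : 36*y^2 - 169 = 0 := by
      rcases mul_eq_zero.mp h1 with h | h
      · exact pow_eq_zero_iff (three_ne_zero) |>.mp h
      · exfalso
        have h3 : y^2 = 25/36 := by linarith
        rw [h3] at hV
        norm_num at hV
    have h3 : (y - 13/6) * (y + 13/6) = 0 := by linear_combination h2/36
    rcases mul_eq_zero.mp h3 with h | h
    · left; exact ⟨rfl, by linarith⟩
    · right; exact ⟨rfl, by linarith⟩
  · rintro (⟨rfl, rfl⟩ | ⟨rfl, rfl⟩) <;> unfold g18 <;> norm_num
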